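/- arXiv:1808.04783 — 2 statements merged into one kernel-verified Lean document; each statement's English description precedes it below -/
import Mathlib

section
/- Let P ∈ ℤ[x] be a monic polynomial of degree n. Then there exists a positive integer N such that for every prime number l > N the following holds: if A and B are n×n matrices over the l-adic integers ℤ_l, both having characteristic polynomial equal to the image of P in ℤ_l[x], and both having squarefree minimal polynomial when regarded as matrices over ℚ_l, then there exists a matrix U ∈ GL_n(ℤ_l) with B = U · A · U⁻¹. -/
open Polynomial

lemma aux_not_isUnit_mat {F : Type*} [Field F] {ι : Type*} [Fintype ι] [DecidableEq ι]
    (A : Matrix ι ι F) (q : F[X]) (hq : Irreducible q) (hd : q ∣ A.charpoly) :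
    ¬ IsUnit (aeval A q) := by
  intro hu
  have : Fact (Irreducible q) := ⟨hq⟩
  let φ : Matrix ι ι F →ₐ[F] Matrix ι ι (AdjoinRoot q) := (Algebra.ofId F (AdjoinRoot q)).mapMatrix
  have hroot : AdjoinRoot.root q ∈ spectrum (AdjoinRoot q) (φ A) := by
    rw [Matrix.mem_spectrum_iff_isRoot_charpoly]
    have : (φ A).charpoly = A.charpoly.map (algebraMap F (AdjoinRoot q)) :=
      Matrix.charpoly_map A (algebraMap F (AdjoinRoot q))
    rw [this, IsRoot.def, eval_map_algebraMap]
    obtain ⟨r, hr⟩ := hd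
    rw [hr, map_mul, AdjoinRoot.aeval_eq, AdjoinRoot.mk_self, zero_mul]
  have h2 := spectrum.subset_polynomial_aeval (φ A) (q.map (algebraMap F (AdjoinRoot q)))
    ⟨_, hroot, rfl⟩
  simp only [eval_map_algebraMap, AdjoinRoot.aeval_eq, AdjoinRoot.mk_self, aeval_map_algebraMap] at h2
  rw [spectrum.zero_mem_iff, aeval_algHom_apply] at h2
  exact h2 (hu.map φ)

lemma aux_not_isUnit {F : Type*} [Field F] {M : Type*} [AddCommGroup M] [Module F M]
    [FiniteDimensional F M]
    (f : Module.End F M) (q : F[X]) (hq : Irreducible q) (hd : q ∣ f.charpoly) :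
    ¬ IsUnit (aeval f q) := by
  intro hu
  let b := Module.finBasis F M
  apply aux_not_isUnit_mat (LinearMap.toMatrixAlgEquiv b f) q hq
  · rwa [← LinearMap.charpoly_toMatrix f b] at hd
  · rw [aeval_algHom_apply (LinearMap.toMatrixAlgEquiv b)]
    exact hu.map _

lemma aux_exists_vec {F : Type*} [Field F] {M : Type*} [AddCommGroup M] [Module F M]
    [FiniteDimensional F M] [Module F[X] M] [IsScalarTower F F[X] M]
    (q : F[X]) (hq : Irreducible q) (hd : q ∣ (Algebra.lsmul F F M (X : F[X])).charpoly) :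
    ∃ v : M, v ≠ 0 ∧ Ideal.torsionOf F[X] M v = Ideal.span {q} := by
  have h := aux_not_isUnit _ q hq hd
  rw [aeval_algHom_apply, aeval_X_left_apply] at h
  rw [LinearMap.isUnit_iff_ker_eq_bot, Submodule.eq_bot_iff] at h
  push Not at h
  obtain ⟨v, hv, hv0⟩ := h
  have hv : q • v = 0 := hv
  refine ⟨v, hv0, ?_⟩
  have hmax : (Ideal.span {q}).IsMaximal := PrincipalIdealRing.isMaximal_of_irreducible hq
  refine (hmax.eq_of_le ?_ ?_).symm
  · intro h
    rw [Ideal.torsionOf_eq_top_iff] at h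
    exact hv0 h
  · rw [Ideal.span_singleton_le_iff_mem]
    exact hv

lemma aux_charpoly_equiv {F : Type*} [Field F] {M N : Type*} [AddCommGroup M] [Module F M]
    [FiniteDimensional F M] [Module F[X] M] [IsScalarTower F F[X] M]
    [AddCommGroup N] [Module F N]
    [FiniteDimensional F N] [Module F[X] N] [IsScalarTower F F[X] N]
    (e : M ≃ₗ[F[X]] N) :
    (Algebra.lsmul F F M (X : F[X])).charpoly = (Algebra.lsmul F F N (X : F[X])).charpoly := by
  rw [← (e.restrictScalars F).charpoly_conj]
  congr 1
  ext x
  simp [LinearEquiv.conj_apply]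

lemma aux_charpoly_compl {F : Type*} [Field F] {M : Type*} [AddCommGroup M] [Module F M]
    [FiniteDimensional F M] [Module F[X] M] [IsScalarTower F F[X] M]
    (S C : Submodule F[X] M) (h : IsCompl S C)
    [FiniteDimensional F S] [FiniteDimensional F C] :
    (Algebra.lsmul F F M (X : F[X])).charpoly =
      (Algebra.lsmul F F S (X : F[X])).charpoly * (Algebra.lsmul F F C (X : F[X])).charpoly := by
  rw [← aux_charpoly_equiv (S.prodEquivOfIsCompl C h), ← LinearMap.charpoly_prodMap]
  congr 1

lemma aux_iso {F : Type*} [Field F] (d : ℕ) : ∀ (M N : Type) [AddCommGroup M] [Module F M]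
    [FiniteDimensional F M] [Module F[X] M] [IsScalarTower F F[X] M]
    [AddCommGroup N] [Module F N]
    [FiniteDimensional F N] [Module F[X] N] [IsScalarTower F F[X] N]
    [IsSemisimpleModule F[X] M] [IsSemisimpleModule F[X] N],
    (Algebra.lsmul F F M (X : F[X])).charpoly = (Algebra.lsmul F F N (X : F[X])).charpoly →
    Module.finrank F M = d →
    Nonempty (M ≃ₗ[F[X]] N) := by
  induction d using Nat.strong_induction_on with
  | _ d ih =>
  intro M N _ _ _ _ _ _ _ _ _ _ _ _ hc hd
  have hN : Module.finrank F N = d := by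
    rw [← LinearMap.charpoly_natDegree (Algebra.lsmul F F N (X : F[X])), ← hc,
      LinearMap.charpoly_natDegree, hd]
  rcases Nat.eq_zero_or_pos d with h0 | hpos
  · subst h0
    have := Module.finrank_zero_iff.1 hd
    have := Module.finrank_zero_iff.1 hN
    exact ⟨LinearEquiv.ofSubsingleton M N⟩
  obtain ⟨q, hq, hqd⟩ : ∃ q, Irreducible q ∧ q ∣ (Algebra.lsmul F F M (X : F[X])).charpoly := by
    apply WfDvdMonoid.exists_irreducible_factor
    · intro hu
      have := natDegree_eq_zero_of_isUnit hu
      rw [LinearMap.charpoly_natDegree] at this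
      omega
    · exact (LinearMap.charpoly_monic _).ne_zero
  obtain ⟨v, hv0, hv⟩ := aux_exists_vec q hq hqd
  obtain ⟨w, hw0, hw⟩ := aux_exists_vec q hq (hc ▸ hqd)
  let S := Submodule.span F[X] {v}
  let T := Submodule.span F[X] {w}
  obtain ⟨C, hC⟩ := exists_isCompl S
  obtain ⟨D, hD⟩ := exists_isCompl T
  have fd (V : Type) [AddCommGroup V] [Module F V]
    [FiniteDimensional F V] [Module F[X] V] [IsScalarTower F F[X] V] (S : Submodule F[X] V) :
      FiniteDimensional F S := FiniteDimensional.finiteDimensional_submodule (S.restrictScalars F)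
  have := fd M S
  have := fd M C
  have := fd N T
  have := fd N D
  let e : S ≃ₗ[F[X]] T := (Ideal.quotTorsionOfEquivSpanSingleton F[X] M v).symm ≪≫ₗ
    Submodule.quotEquivOfEq _ _ (hv.trans hw.symm) ≪≫ₗ
    (Ideal.quotTorsionOfEquivSpanSingleton F[X] N w)
  have hCD : (Algebra.lsmul F F C (X : F[X])).charpoly
      = (Algebra.lsmul F F D (X : F[X])).charpoly := by
    rw [aux_charpoly_compl S C hC, aux_charpoly_compl T D hD, aux_charpoly_equiv e] at hc
    exact mul_left_cancel₀ (LinearMap.charpoly_monic _).ne_zero hc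
  have hlt : Module.finrank F C < d := by
    rw [← hd]
    refine Submodule.finrank_lt (s := C.restrictScalars F) ?_
    intro h
    have : C = ⊤ := by simpa using h
    subst this
    have : S = ⊥ := by
      have h := hC.inf_eq_bot
      rwa [inf_top_eq] at h
    exact hv0 (by simpa [S] using this)
  obtain ⟨g⟩ := ih _ hlt C D hCD rfl
  exact ⟨(S.prodEquivOfIsCompl C hC).symm ≪≫ₗ (e.prodCongr g) ≪≫ₗ (T.prodEquivOfIsCompl D hD)⟩

lemma aux_conj_field {F : Type} [Field F] {n : ℕ} (A B : Matrix (Fin n) (Fin n) F) (Q : F[X])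
    (hQ : Squarefree Q) (hA : aeval A Q = 0) (hB : aeval B Q = 0) (hc : A.charpoly = B.charpoly) :
    ∃ U : Matrix (Fin n) (Fin n) F, IsUnit U.det ∧ B * U = U * A := by
  have ss (A : Matrix (Fin n) (Fin n) F) (hA : aeval A Q = 0) :
      IsSemisimpleModule F[X] (Module.AEval' (Matrix.toLin' A)) := by
    refine Module.End.isSemisimple_of_squarefree_aeval_eq_zero hQ ?_
    have := aeval_algHom_apply (Matrix.toLinAlgEquiv' : Matrix (Fin n) (Fin n) F ≃ₐ[F] _) A Q
    rw [hA, map_zero] at this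
    exact this
  have cp (A : Matrix (Fin n) (Fin n) F) : (Algebra.lsmul F F (Module.AEval' (Matrix.toLin' A))
      (X : F[X])).charpoly = A.charpoly := by
    rw [← Matrix.charpoly_toLin', ← (Module.AEval'.of (Matrix.toLin' A)).charpoly_conj]
    congr 1
    ext x
    simp [LinearEquiv.conj_apply]
    exact (Module.AEval'.X_smul_of (Matrix.toLin' A) ((Module.AEval'.of (Matrix.toLin' A)).symm x))
  have := ss A hA
  have := ss B hB
  obtain ⟨e⟩ := aux_iso _ (Module.AEval' (Matrix.toLin' A)) (Module.AEval' (Matrix.toLin' B))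
    (by rw [cp, cp, hc]) rfl
  let g : (Fin n → F) ≃ₗ[F] (Fin n → F) := Module.AEval'.of (Matrix.toLin' A) ≪≫ₗ
    e.restrictScalars F ≪≫ₗ (Module.AEval'.of (Matrix.toLin' B)).symm
  refine ⟨LinearMap.toMatrix' g.toLinearMap, ?_, ?_⟩
  · rw [LinearMap.det_toMatrix']
    exact LinearEquiv.isUnit_det' g
  · apply Matrix.toLin'.injective
    ext1 x
    rw [Matrix.toLin'_mul, Matrix.toLin'_mul, Matrix.toLin'_toMatrix']
    ext1
    simp only [LinearMap.comp_apply]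
    generalize (LinearMap.single F (fun _ : Fin n => F) x) 1 = y
    change _ = (Module.AEval'.of (Matrix.toLin' B)).symm (e (Module.AEval'.of (Matrix.toLin' A) (Matrix.toLin' A y)))
    rw [← Module.AEval'.X_smul_of, map_smul, Module.AEval'.of_symm_X_smul]
    rfl

lemma aux_lift {S T : Type*} [Ring S] [Algebra ℤ S] [Ring T] (φ : S →+* T) (A B U : S)
    (h : φ B * φ U = φ U * φ A) (Q : ℤ[X]) :
    ∃ V : S, B * V - V * A = aeval B Q * U - U * aeval A Q ∧
      φ V = φ U * φ (aeval A (derivative Q)) := by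
  induction Q using Polynomial.induction_on' with
  | add p q hp hq =>
    obtain ⟨V, h1, h2⟩ := hp
    obtain ⟨W, h3, h4⟩ := hq
    refine ⟨V + W, ?_, ?_⟩
    · simp only [map_add, add_mul, mul_add]
      have h5 := congrArg₂ (· + ·) h1 h3
      rw [← sub_eq_zero] at h5 ⊢
      rw [← h5]
      abel
    · simp only [map_add, mul_add, h2, h4]
  | monomial k c =>
    have key : ∃ V : S, B * V - V * A = B ^ k * U - U * A ^ k ∧
        φ V = φ U * ((k : T) * φ A ^ (k - 1)) := by
      induction k with
      | zero => exact ⟨0, by simp, by simp⟩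
      | succ k ih =>
        obtain ⟨V, h1, h2⟩ := ih
        refine ⟨B * V + U * A ^ k, ?_, ?_⟩
        · have : B * (B * V + U * A ^ k) - (B * V + U * A ^ k) * A
            = B * (B * V - V * A) + B * U * A ^ k - U * A ^ (k+1) := by
            rw [pow_succ]; noncomm_ring
          rw [this, h1, pow_succ' B]; noncomm_ring
        · rw [map_add, map_mul, map_mul, h2, ← mul_assoc, h, map_pow]
          rcases k with _ | k
          · simp
          · have : φ A * (((k + 1 : ℕ) : T) * φ A ^ k) = ((k + 1 : ℕ) : T) * φ A ^ (k+1) := by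
              rw [← mul_assoc, ← Nat.cast_comm, mul_assoc, pow_succ']
            simp only [Nat.add_sub_cancel]
            rw [mul_assoc, this, ← mul_add, Nat.cast_succ (k+1), add_mul, one_mul]
    obtain ⟨V, h1, h2⟩ := key
    refine ⟨c • V, ?_, ?_⟩
    · simp only [aeval_monomial, mul_smul_comm, smul_mul_assoc, ← smul_sub, h1,
        eq_intCast, ← zsmul_eq_mul]
    · rw [map_zsmul, h2, derivative_monomial]
      simp only [aeval_monomial, eq_intCast, map_mul, map_intCast, map_pow,
        Int.cast_mul, Int.cast_natCast, ← zsmul_eq_mul, smul_mul_assoc, mul_smul_comm, map_zsmul,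
        map_natCast]

lemma aux_poly (P : ℤ[X]) (hP : P.Monic) : ∃ (Q a b : ℤ[X]) (d : ℤ) (m : ℕ), d ≠ 0 ∧
    a * Q + b * derivative Q = C d ∧
    P.map (Int.castRingHom ℚ) ∣ Q.map (Int.castRingHom ℚ) ^ (m + 1) := by
  have clear (f : ℚ[X]) : ∃ (c : ℤ) (g : ℤ[X]), c ≠ 0 ∧ g.map (Int.castRingHom ℚ) = C (c : ℚ) * f := by
    obtain ⟨⟨c, hc⟩, h⟩ := IsLocalization.integerNormalization_map_to_map (nonZeroDivisors ℤ) f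
    refine ⟨c, _, nonZeroDivisors.ne_zero hc, h.trans ?_⟩
    ext; simp
  set p := P.map (Int.castRingHom ℚ)
  have hp : p ≠ 0 := (hP.map _).ne_zero
  let r := UniqueFactorizationMonoid.radical p
  have hsep : r.Separable := PerfectField.separable_iff_squarefree.2
    UniqueFactorizationMonoid.squarefree_radical
  obtain ⟨m, hm⟩ := UniqueFactorizationMonoid.exists_dvd_radical_self_pow hp
  obtain ⟨c, Q, hc, hQ⟩ := clear r
  have hcu : IsUnit (C (c : ℚ)) := isUnit_C.2 (by simpa using hc)
  have hsep' : (Q.map (Int.castRingHom ℚ)).Separable := by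
    rw [hQ]; exact Separable.unit_mul hcu hsep
  obtain ⟨a, b, hab⟩ := hsep'
  obtain ⟨s, a', hs, ha⟩ := clear a
  obtain ⟨t, b', ht, hb⟩ := clear b
  refine ⟨Q, C t * a', C s * b', s * t, m, mul_ne_zero hs ht, ?_, ?_⟩
  · apply map_injective (Int.castRingHom ℚ) Int.cast_injective
    simp only [Polynomial.map_add, Polynomial.map_mul, ha, hb, map_C, ← derivative_map]
    simp only [eq_intCast, Int.cast_mul, C_mul]
    linear_combination (C (s:ℚ) * C (t:ℚ)) * hab
  · rw [hQ, mul_pow]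
    exact (hm.trans (pow_dvd_pow _ (Nat.le_succ m))).trans (Dvd.intro_left _ rfl)

lemma aux_kill (l : ℕ) [Fact l.Prime] {n : ℕ} (P Q : ℤ[X]) (m : ℕ)
    (h : P.map (Int.castRingHom ℚ) ∣ Q.map (Int.castRingHom ℚ) ^ (m + 1))
    (A : Matrix (Fin n) (Fin n) ℤ_[l]) (hA : A.charpoly = P.map (Int.castRingHom ℤ_[l]))
    (hs : Squarefree (minpoly ℚ_[l] (A.map (fun x : ℤ_[l] => (x : ℚ_[l]))))) :
    aeval A Q = 0 := by
  let φ := (PadicInt.Coe.ringHom (p := l)).mapMatrix (m := Fin n)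
  have hφ : Function.Injective φ := Matrix.map_injective Subtype.val_injective
  change Squarefree (minpoly ℚ_[l] (φ A)) at hs
  have h1 : (φ A).charpoly = P.map (Int.castRingHom ℚ_[l]) := by
    have : (φ A).charpoly = A.charpoly.map (PadicInt.Coe.ringHom (p := l)) :=
      Matrix.charpoly_map A _
    rw [this, hA, map_map]; congr 1
  have h2 : P.map (Int.castRingHom ℚ_[l]) ∣ Q.map (Int.castRingHom ℚ_[l]) ^ (m + 1) := by
    have := Polynomial.map_dvd (algebraMap ℚ ℚ_[l]) h
    rw [Polynomial.map_pow, map_map, map_map] at this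
    rwa [RingHom.ext_int ((algebraMap ℚ ℚ_[l]).comp (Int.castRingHom ℚ)) (Int.castRingHom ℚ_[l])] at this
  have h3 := (Matrix.minpoly_dvd_charpoly (φ A)).trans (h1 ▸ h2)
  rw [hs.dvd_pow_iff_dvd (Nat.succ_ne_zero m)] at h3
  have h4 := (minpoly.dvd_iff).1 h3
  apply hφ
  rw [map_zero, ← h4]
  have : aeval (φ A) (Q.map (algebraMap ℤ ℚ_[l])) = aeval (φ A) Q := aeval_map_algebraMap _ _ _
  refine Eq.trans ?_ this.symm
  exact (aeval_algHom_apply φ.toIntAlgHom A Q).symm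

theorem conj_over_Zl_of_large_l (n : ℕ) (P : Polynomial ℤ) (hP : P.Monic)
    (hdeg : P.natDegree = n) :
    ∃ N : ℕ, 0 < N ∧ ∀ (l : ℕ) [Fact l.Prime], N < l →
      ∀ A B : Matrix (Fin n) (Fin n) ℤ_[l],
        A.charpoly = P.map (Int.castRingHom ℤ_[l]) →
        B.charpoly = P.map (Int.castRingHom ℤ_[l]) →
        Squarefree (minpoly ℚ_[l] (A.map (fun x : ℤ_[l] => (x : ℚ_[l])))) →
        Squarefree (minpoly ℚ_[l] (B.map (fun x : ℤ_[l] => (x : ℚ_[l])))) →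
        ∃ U : GL (Fin n) ℤ_[l],
          B = (U : Matrix (Fin n) (Fin n) ℤ_[l]) * A * ((U⁻¹ : GL (Fin n) ℤ_[l]) :
            Matrix (Fin n) (Fin n) ℤ_[l]) := by
  obtain ⟨Q, a, b, d, m, hd, hab, hdvd⟩ := aux_poly P hP
  refine ⟨d.natAbs, Int.natAbs_pos.2 hd, ?_⟩
  intro l _ hl A B hA hB hsA hsB
  have hQA := aux_kill l P Q m hdvd A hA hsA
  have hQB := aux_kill l P Q m hdvd B hB hsB
  have hdl : (d : ZMod l) ≠ 0 := by
    rw [Ne, ZMod.intCast_zmod_eq_zero_iff_dvd]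
    intro h
    have := Nat.le_of_dvd (Int.natAbs_pos.2 hd) (Int.natCast_dvd.1 h)
    omega
  let π := PadicInt.toZMod (p := l)
  let φ := π.mapMatrix (m := Fin n)
  have hsep : (Q.map (Int.castRingHom (ZMod l))).Separable := by
    refine ⟨C (d : ZMod l)⁻¹ * a.map (Int.castRingHom (ZMod l)),
      C (d : ZMod l)⁻¹ * b.map (Int.castRingHom (ZMod l)), ?_⟩
    have := congrArg (Polynomial.map (Int.castRingHom (ZMod l))) hab
    simp only [Polynomial.map_add, Polynomial.map_mul, map_C, ← derivative_map] at this
    rw [eq_intCast] at this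
    rw [mul_assoc, mul_assoc, ← mul_add, this, ← C_mul, inv_mul_cancel₀ hdl, C_1]
  have kill (A : Matrix (Fin n) (Fin n) ℤ_[l]) (hQA : aeval A Q = 0) :
      aeval (φ A) (Q.map (Int.castRingHom (ZMod l))) = 0 := by
    have : aeval (φ A) (Q.map (algebraMap ℤ (ZMod l))) = aeval (φ A) Q :=
      aeval_map_algebraMap _ _ _
    refine this.trans ?_
    refine (aeval_algHom_apply φ.toIntAlgHom A Q).trans ?_
    rw [hQA, map_zero]
  have hc : (φ A).charpoly = (φ B).charpoly := by
    have hh (A : Matrix (Fin n) (Fin n) ℤ_[l]) : (φ A).charpoly = A.charpoly.map π :=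
      Matrix.charpoly_map A _
    rw [hh, hh, hA, hB]
  obtain ⟨U₀, hU₀, hU₀'⟩ := aux_conj_field (φ A) (φ B) _ hsep.squarefree (kill A hQA) (kill B hQB) hc
  have hsurj : Function.Surjective π := ZMod.ringHom_surjective π
  obtain ⟨U, rfl⟩ : ∃ U, φ U = U₀ := by
    choose s hs using hsurj
    exact ⟨U₀.map s, by ext i j; simp [φ, hs]⟩
  obtain ⟨V, hV1, hV2⟩ := aux_lift φ A B U hU₀' Q
  rw [hQA, hQB, zero_mul, mul_zero, sub_zero, sub_eq_zero] at hV1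
  have hder : aeval A (derivative Q) * aeval A b = (d : Matrix (Fin n) (Fin n) ℤ_[l]) := by
    have := congrArg (aeval A) hab
    rw [map_add, map_mul, hQA, mul_zero, zero_add, mul_comm, map_mul] at this
    simpa using this
  let W := V * aeval A b
  have hW1 : B * W = W * A := by
    have : A * aeval A b = aeval A b * A := by
      have h := congrArg (aeval A) (mul_comm X b)
      simpa using h
    simp only [W]
    rw [← mul_assoc, hV1, mul_assoc, this, mul_assoc]
  have hW2 : φ W = φ U * (d : Matrix (Fin n) (Fin n) (ZMod l)) := by
    simp only [W]
    rw [map_mul, hV2, mul_assoc, ← map_mul, hder, map_intCast]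
  have hdetW : IsUnit W.det := by
    by_contra hcon
    have h0 : π W.det = 0 := by
      rw [← RingHom.mem_ker, PadicInt.ker_toZMod]
      exact hcon
    rw [RingHom.map_det] at h0
    change (φ W).det = 0 at h0
    rw [hW2, Matrix.det_mul, mul_eq_zero] at h0
    rcases h0 with h0 | h0
    · exact hU₀.ne_zero h0
    · have : (d : Matrix (Fin n) (Fin n) (ZMod l)) = Matrix.diagonal fun _ => (d : ZMod l) := rfl
      rw [this, Matrix.det_diagonal] at h0
      exact (Finset.prod_ne_zero_iff.2 fun _ _ => hdl) h0
  obtain ⟨G, hG⟩ := (Matrix.isUnit_iff_isUnit_det W).2 hdetW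
  refine ⟨G, ?_⟩
  rw [Units.eq_mul_inv_iff_mul_eq, hG, hW1]
end

section
/- Let P = P_1 · P_2 · ⋯ · P_s be a monic polynomial in ℤ[x] where the P_i are monic and pairwise coprime in ℚ[x], and set K_i = ∏_{j≠i} P_j. Then there exists a positive integer N such that for every prime l > N and every endomorphism π of a finite free module T over the l-adic integers ℤ_l whose characteristic polynomial is the image of P: the module T decomposes as the internal direct sum T = ⊕_{i=1}^s K_i(π)(T), each submodule K_i(π)(T) is stable under π, and the characteristic polynomial of the restriction of π to K_i(π)(T) is the image of P_i. -/
open Polynomial in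
theorem aux_bezout (p q : ℤ[X])
    (h : IsCoprime (p.map (Int.castRingHom ℚ)) (q.map (Int.castRingHom ℚ))) :
    ∃ d : ℕ, d ≠ 0 ∧ ∃ a b : ℤ[X], a * p + b * q = C (d : ℤ) := by
  obtain ⟨u, v, huv⟩ := h
  obtain ⟨m, hm, hu⟩ := IsLocalization.integerNormalization_spec (nonZeroDivisors ℤ) u
  obtain ⟨n, hn, hv⟩ := IsLocalization.integerNormalization_spec (nonZeroDivisors ℤ) v
  set a := IsLocalization.integerNormalization (nonZeroDivisors ℤ) u
  set b := IsLocalization.integerNormalization (nonZeroDivisors ℤ) v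
  have hm0 : m ≠ 0 := nonZeroDivisors.ne_zero hm
  have hn0 : n ≠ 0 := nonZeroDivisors.ne_zero hn
  have key : (C n * a) * p + (C m * b) * q = C (m * n) := by
    apply Polynomial.map_injective (Int.castRingHom ℚ) Int.cast_injective
    have e : algebraMap ℤ ℚ = Int.castRingHom ℚ := rfl
    rw [e] at hu hv
    simp only [Polynomial.map_add, Polynomial.map_mul, hu, hv, map_C]
    simp only [zsmul_eq_mul, eq_intCast, map_mul, map_intCast]
    linear_combination ((m : ℚ[X]) * n) * huv
  refine ⟨(m * n).natAbs, by simp [hm0, hn0], ?_⟩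
  rcases Int.natAbs_eq (m * n) with h | h
  · exact ⟨_, _, by rw [← h]; exact key⟩
  · refine ⟨-(C n * a), -(C m * b), ?_⟩
    rw [show (((m * n).natAbs : ℕ) : ℤ) = -(m * n) by omega, C_neg, ← key]
    ring

open Polynomial in
theorem aux_coprime_padic (p q : ℤ[X]) (d : ℕ) (hd : d ≠ 0) (a b : ℤ[X])
    (h : a * p + b * q = C (d : ℤ)) (l : ℕ) [Fact l.Prime] (hl : d < l) :
    IsCoprime (p.map (Int.castRingHom ℤ_[l])) (q.map (Int.castRingHom ℤ_[l])) := by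
  have hu : IsUnit (d : ℤ_[l]) := by
    rw [PadicInt.isUnit_iff]
    by_contra hne
    have h1 : ‖((d : ℤ) : ℤ_[l])‖ < 1 := by
      have := PadicInt.norm_le_one (p := l) (d : ℤ_[l])
      push_cast
      exact lt_of_le_of_ne this hne
    rw [PadicInt.norm_int_lt_one_iff_dvd] at h1
    have := Nat.le_of_dvd (Nat.pos_of_ne_zero hd) (by exact_mod_cast h1)
    omega
  obtain ⟨e, he⟩ := hu.exists_left_inv
  refine ⟨C e * a.map (Int.castRingHom ℤ_[l]), C e * b.map (Int.castRingHom ℤ_[l]), ?_⟩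
  have := congrArg (Polynomial.map (Int.castRingHom ℤ_[l])) h
  simp only [Polynomial.map_add, Polynomial.map_mul, map_C] at this
  calc _ = C e * (a.map (Int.castRingHom ℤ_[l]) * p.map (Int.castRingHom ℤ_[l])
        + b.map (Int.castRingHom ℤ_[l]) * q.map (Int.castRingHom ℤ_[l])) := by ring
    _ = 1 := by rw [this, ← C_mul]; simp [he]

open Polynomial in
theorem aux_matrix_charpoly_dvd {R n : Type*} [CommRing R] [Fintype n] [DecidableEq n]
    (A : Matrix n n R) (q : R[X]) (hq : aeval A q = 0) : A.charpoly ∣ q ^ Fintype.card n := by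
  have h := X_sub_C_dvd_sub_C_eval (p := q.map (C : R →+* R[X])) (a := (X : R[X]))
  have h2 := map_dvd (aeval (R := R[X]) (A.map (C : R →+* R[X]))) h
  have e1 : aeval (R := R[X]) (A.map (C : R →+* R[X])) (q.map (C : R →+* R[X])) = 0 := by
    have : aeval (R := R[X]) (A.map (C : R →+* R[X])) (q.map (C : R →+* R[X]))
        = (C : R →+* R[X]).mapMatrix (aeval A q) := by
      rw [aeval_def, eval₂_map, aeval_def, hom_eval₂]
      congr 1
      ext r i j
      by_cases hij : i = j <;> simp [Matrix.algebraMap_matrix_apply, hij]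
    rw [this, hq, map_zero]
  have e2 : (q.map (C : R →+* R[X])).eval X = q := by
    rw [eval_map, eval₂_C_X]
  rw [map_sub, map_sub, e1, e2, aeval_X, aeval_C, aeval_C, zero_sub, dvd_neg,
    ← neg_dvd, neg_sub] at h2
  obtain ⟨B, hB⟩ := h2
  refine ⟨B.det, ?_⟩
  have := congrArg Matrix.det hB
  rw [Matrix.det_mul] at this
  rw [show A.charpoly = (algebraMap R[X] (Matrix n n R[X]) X - A.map C).det from rfl, ← this]
  rw [Algebra.algebraMap_eq_smul_one, Matrix.det_smul, Matrix.det_one, mul_one]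

open Polynomial in
theorem aux_charpoly_dvd {R M : Type*} [CommRing R] [Nontrivial R] [AddCommGroup M] [Module R M]
    [Module.Finite R M] [Module.Free R M] (f : M →ₗ[R] M) (q : R[X]) (hq : aeval f q = 0) :
    ∃ n : ℕ, f.charpoly ∣ q ^ n := by
  classical
  let b := Module.Free.chooseBasis R M
  refine ⟨_, aux_matrix_charpoly_dvd (LinearMap.toMatrix b b f) q ?_⟩
  have : aeval (LinearMap.toMatrixAlgEquiv b f) q = 0 := by
    rw [aeval_algEquiv, AlgHom.comp_apply, hq]; simp
  exact this

theorem aux_det {S ι : Type*} {m : ι → Type*} [CommRing S] [Fintype ι] [LinearOrder ι]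
    [∀ i, Fintype (m i)] [∀ i, DecidableEq (m i)] (d : ∀ i, Matrix (m i) (m i) S) :
    (Matrix.blockDiagonal' d).det = ∏ i, (d i).det := by
  rw [(Matrix.blockTriangular_blockDiagonal' d).det_fintype]
  refine Finset.prod_congr rfl fun k _ => ?_
  let e : m k ≃ {a : Σ i, m i // a.1 = k} :=
    { toFun := fun x => ⟨⟨k, x⟩, rfl⟩
      invFun := fun a => a.2 ▸ a.1.2
      left_inv := fun x => rfl
      right_inv := by rintro ⟨⟨i, x⟩, rfl⟩; rfl }
  rw [← Matrix.det_submatrix_equiv_self e]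
  congr 1
  ext x y
  exact Matrix.blockDiagonal'_apply_eq d k x y

open Polynomial in
theorem aux_charpoly_prod {R M ι : Type*} [CommRing R] [Nontrivial R] [AddCommGroup M]
    [Module R M] [Fintype ι] [LinearOrder ι]
    [Module.Finite R M] [Module.Free R M] (N : ι → Submodule R M)
    [∀ i, Module.Finite R (N i)] [∀ i, Module.Free R (N i)]
    (hN : DirectSum.IsInternal N) (f : M →ₗ[R] M) (hf : ∀ i, Set.MapsTo f (N i) (N i)) :
    f.charpoly = ∏ i, (f.restrict (hf i)).charpoly := by
  classical
  let b := fun i => Module.Free.chooseBasis R (N i)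
  rw [← LinearMap.charpoly_toMatrix f (hN.collectedBasis b),
    LinearMap.toMatrix_directSum_collectedBasis_eq_blockDiagonal' hN hN b b hf]
  rw [Matrix.charpoly]
  have : (Matrix.blockDiagonal' fun i ↦
      LinearMap.toMatrix (b i) (b i) (f.restrict (hf i))).charmatrix =
      Matrix.blockDiagonal' fun i ↦
        (LinearMap.toMatrix (b i) (b i) (f.restrict (hf i))).charmatrix := by
    unfold Matrix.charmatrix
    ext ⟨i, x⟩ ⟨j, y⟩ : 2
    rcases eq_or_ne i j with rfl | hij
    · rcases eq_or_ne x y with rfl | hxy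
      · simp [Matrix.blockDiagonal'_apply]
      · simp [Matrix.blockDiagonal'_apply, hxy]
    · simp [Matrix.blockDiagonal'_apply, hij]
  rw [this, aux_det]
  exact Finset.prod_congr rfl fun i _ => LinearMap.charpoly_toMatrix _ (b i)

open Polynomial in
theorem aux_main {R M ι : Type*} [CommRing R] [IsDomain R] [IsPrincipalIdealRing R]
    [AddCommGroup M] [Module R M] [Fintype ι] [LinearOrder ι]
    [Module.Finite R M] [Module.Free R M] (Q : ι → R[X]) (hQ : ∀ i, (Q i).Monic)
    (hcop : Pairwise fun i j => IsCoprime (Q i) (Q j)) (f : M →ₗ[R] M)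
    (hf : f.charpoly = ∏ i, Q i)
    (N : ι → Submodule R M)
    (hN : ∀ i, N i = LinearMap.range (aeval f (∏ j ∈ Finset.univ.erase i, Q j))) :
    (∀ i, ∀ x ∈ N i, f x ∈ N i) ∧ DirectSum.IsInternal N ∧
      ∀ i (h : ∀ x ∈ N i, f x ∈ N i), (f.restrict h).charpoly = Q i := by
  have hst : ∀ i, ∀ x ∈ N i, f x ∈ N i := by
    intro i x hx
    rw [hN] at hx ⊢
    obtain ⟨y, rfl⟩ := hx
    refine ⟨f y, ?_⟩
    have := congrArg (fun g => aeval f g) (mul_comm (∏ j ∈ Finset.univ.erase i, Q j) X)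
    simp only [map_mul, aeval_X] at this
    exact LinearMap.congr_fun this y
  have hker : ∀ i, N i ≤ LinearMap.ker (aeval f (Q i)) := by
    intro i x hx
    rw [hN] at hx
    obtain ⟨y, rfl⟩ := hx
    have h0 := LinearMap.aeval_self_charpoly f
    rw [hf, ← Finset.mul_prod_erase _ _ (Finset.mem_univ i), map_mul] at h0
    exact LinearMap.congr_fun h0 y
  have hind : iSupIndep N := by
    intro i
    have hc : IsCoprime (Q i) (∏ j ∈ Finset.univ.erase i, Q j) :=
      IsCoprime.prod_right fun j hj => hcop (Finset.ne_of_mem_erase hj).symm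
    refine (disjoint_ker_aeval_of_isCoprime f hc).mono (hker i) ?_
    refine iSup₂_le fun j hj => (hker j).trans ?_
    intro x hx
    obtain ⟨g, hg⟩ := Finset.dvd_prod_of_mem Q (Finset.mem_erase.2 ⟨hj, Finset.mem_univ j⟩)
    rw [LinearMap.mem_ker] at hx ⊢
    rw [hg, mul_comm, map_mul, Module.End.mul_apply, hx, map_zero]
  have htop : iSup N = ⊤ := by
    rcases isEmpty_or_nonempty ι with hι | hι
    · have h0 := LinearMap.aeval_self_charpoly f
      rw [hf, Finset.univ_eq_empty, Finset.prod_empty, map_one] at h0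
      refine eq_top_iff.2 fun x _ => ?_
      have : x = 0 := LinearMap.congr_fun h0 x
      rw [this]; exact zero_mem _
    · obtain ⟨μ, hμ⟩ := exists_sum_eq_one_iff_pairwise_coprime'.2 hcop
      refine eq_top_iff.2 fun x _ => ?_
      have h1 := LinearMap.congr_fun (congrArg (fun g => aeval f g) hμ) x
      simp only [map_sum, map_one, Module.End.one_apply, LinearMap.sum_apply] at h1
      rw [← h1]
      refine Submodule.sum_mem _ fun i _ => Submodule.mem_iSup_of_mem i ?_
      rw [hN, mul_comm, map_mul]
      refine ⟨aeval f (μ i) x, ?_⟩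
      rw [Module.End.mul_apply, Finset.compl_eq_univ_sdiff, Finset.sdiff_singleton_eq_erase]
  have hint : DirectSum.IsInternal N :=
    (DirectSum.isInternal_submodule_iff_iSupIndep_and_iSup_eq_top N).2 ⟨hind, htop⟩
  refine ⟨hst, hint, ?_⟩
  have hprod := aux_charpoly_prod N hint f hst
  have hann : ∀ i, aeval (f.restrict (hst i)) (Q i) = 0 := by
    intro i
    ext x
    have hx : aeval f (Q i) x = 0 := hker i x.2
    have : ∀ q : R[X], ((aeval (f.restrict (hst i)) q x : N i) : M) = aeval f q x := by
      intro q
      have hsemi : ∀ (n : ℕ) (y : N i), (((f.restrict (hst i)) ^ n) y : M) = (f ^ n) y := by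
        intro n
        induction n with
        | zero => intro y; simp
        | succ n ih => intro y; rw [pow_succ, pow_succ, Module.End.mul_apply, ih]; rfl
      simp [aeval_eq_sum_range, LinearMap.sum_apply, hsemi]
    simp [this, hx]
  have hcc : ∀ i j, i ≠ j → IsCoprime (f.restrict (hst i)).charpoly (Q j) := by
    intro i j hij
    obtain ⟨n, hn⟩ := aux_charpoly_dvd _ _ (hann i)
    exact IsCoprime.of_isCoprime_of_dvd_left ((hcop hij).pow_left) hn
  intro i h
  have hpe := hf.symm.trans hprod
  apply eq_of_monic_of_associated (LinearMap.charpoly_monic _) (hQ i)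
  apply associated_of_dvd_dvd
  · have hd : (f.restrict h).charpoly ∣ ∏ j, Q j := by
      rw [hpe]; exact Finset.dvd_prod_of_mem (fun i => (f.restrict (hst i)).charpoly)
        (Finset.mem_univ i)
    rw [← Finset.mul_prod_erase _ _ (Finset.mem_univ i)] at hd
    exact IsCoprime.dvd_of_dvd_mul_right
      (IsCoprime.prod_right fun j hj => hcc i j (Finset.ne_of_mem_erase hj).symm) hd
  · have hd : Q i ∣ ∏ j, (f.restrict (hst j)).charpoly := by
      rw [← hpe]; exact Finset.dvd_prod_of_mem Q (Finset.mem_univ i)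
    rw [← Finset.mul_prod_erase _ _ (Finset.mem_univ i)] at hd
    exact IsCoprime.dvd_of_dvd_mul_right
      (IsCoprime.prod_right fun j hj => (hcc j i (Finset.ne_of_mem_erase hj)).symm) hd


/-- **Decomposition of a lattice with endomorphism according to coprime factors of the
characteristic polynomial, for large `l`.** Let `P = P₁ ⋯ P_s` with the `P i` monic in `ℤ[x]`
and pairwise coprime over `ℚ`, and `K i = ∏_{j ≠ i} P j`. There is a positive `N` such that
for every prime `l > N` and every endomorphism `π` of a finite free `ℤ_l`-module `T` with
characteristic polynomial the image of `P`, the submodules `K i (π) (T)` are `π`-stable,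
`T` is their internal direct sum, and `π` restricted to `K i (π) (T)` has characteristic
polynomial the image of `P i`. -/
theorem tate_module_decomposition_of_large_l (s : ℕ) (P : Fin s → Polynomial ℤ)
    (hmonic : ∀ i, (P i).Monic)
    (hcop : ∀ i j, i ≠ j →
      IsCoprime ((P i).map (Int.castRingHom ℚ)) ((P j).map (Int.castRingHom ℚ)))
    (K : Fin s → Polynomial ℤ)
    (hK : ∀ i, K i = ∏ j ∈ Finset.univ.erase i, P j) :
    ∃ N : ℕ, 0 < N ∧ ∀ (l : ℕ) [Fact l.Prime], N < l →
      ∀ (T : Type) [AddCommGroup T] [Module ℤ_[l] T] [Module.Finite ℤ_[l] T]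
        [Module.Free ℤ_[l] T] (π : T →ₗ[ℤ_[l]] T),
        π.charpoly = (∏ i, P i).map (Int.castRingHom ℤ_[l]) →
        (∀ i, ∀ x ∈ LinearMap.range (Polynomial.aeval π (K i)),
          π x ∈ LinearMap.range (Polynomial.aeval π (K i))) ∧
        DirectSum.IsInternal (fun i => LinearMap.range (Polynomial.aeval π (K i))) ∧
        ∀ i (h : ∀ x ∈ LinearMap.range (Polynomial.aeval π (K i)),
            π x ∈ LinearMap.range (Polynomial.aeval π (K i))),
          (π.restrict h).charpoly = (P i).map (Int.castRingHom ℤ_[l]) := by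
  choose! d hd0 a b hab using fun i j (hij : i ≠ j) => aux_bezout (P i) (P j) (hcop i j hij)
  refine ⟨1 + ∑ i, ∑ j, d i j, by omega, ?_⟩
  intro l _ hl T _ _ _ _ π hπ
  have hdl : ∀ i j, d i j < l := by
    intro i j
    have h1 := Finset.single_le_sum (f := fun j => d i j) (fun _ _ => Nat.zero_le _)
      (Finset.mem_univ j)
    have h2 := Finset.single_le_sum (f := fun i => ∑ j, d i j) (fun _ _ => Nat.zero_le _)
      (Finset.mem_univ i)
    beta_reduce at h1 h2
    omega
  refine aux_main (fun i => (P i).map (Int.castRingHom ℤ_[l])) (fun i => (hmonic i).map _)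
    (fun i j hij => aux_coprime_padic _ _ (d i j) (hd0 i j hij) _ _ (hab i j hij) l (hdl i j))
    π (by rw [hπ, Polynomial.map_prod]) _ fun i => ?_
  rw [hK, ← Polynomial.map_prod]
  congr 1
  exact (Polynomial.aeval_map_algebraMap ℤ_[l] π _).symm
end
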